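/- PTA-II holds if and only if GMC holds at (λ^DID, w) for every w in the simplex Δ_{K−1}. -/

import Mathlib

open MeasureTheory Classical

noncomputable section

/-- Conditional expectation `E[X | A]`: the expectation of `X` under `P(· | A)`. -/
def cExp {Ω : Type*} [MeasurableSpace Ω] (P : Measure Ω)
    (X : Ω → ℝ) (A : Set Ω) : ℝ :=
  (∫ ω in A, X ω ∂P) / (P A).toReal

/-- The matching error `e_t(λ,w)`, with `p` pre-treatment periods and donor pool
`{1,…,K}`. -/
def eErr {Ω : Type*} [MeasurableSpace Ω] (P : Measure Ω) (G : Ω → ℕ)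
    (Y0 : ℕ → Ω → ℝ) (K p : ℕ) (lam w : ℕ → ℝ) (t : ℕ) : ℝ :=
  cExp P (fun ω => Y0 t ω - ∑ s ∈ Finset.Icc 1 p, lam s * Y0 s ω) {ω | G ω = 0}
    - ∑ j ∈ Finset.Icc 1 K, w j *
        cExp P (fun ω => Y0 t ω - ∑ s ∈ Finset.Icc 1 p, lam s * Y0 s ω) {ω | G ω = j}

/-- The DID matching error `e_t^DID(λ)` of the target group against the pooled donor
groups `{1,…,K}`, with `p` pre-treatment periods. -/
def eDID {Ω : Type*} [MeasurableSpace Ω] (P : Measure Ω) (G : Ω → ℕ)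
    (Y0 : ℕ → Ω → ℝ) (K p : ℕ) (lam : ℕ → ℝ) (t : ℕ) : ℝ :=
  cExp P (fun ω => Y0 t ω - ∑ s ∈ Finset.Icc 1 p, lam s * Y0 s ω) {ω | G ω = 0}
    - cExp P (fun ω => Y0 t ω - ∑ s ∈ Finset.Icc 1 p, lam s * Y0 s ω)
        {ω | G ω ∈ Finset.Icc 1 K}

/-- The groupwise DID matching error `e_{j,t}^DID(λ)` of the target group against donor
group `j`, with `p` pre-treatment periods. -/
def ejDID {Ω : Type*} [MeasurableSpace Ω] (P : Measure Ω) (G : Ω → ℕ)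
    (Y0 : ℕ → Ω → ℝ) (p : ℕ) (lam : ℕ → ℝ) (j t : ℕ) : ℝ :=
  cExp P (fun ω => Y0 t ω - ∑ s ∈ Finset.Icc 1 p, lam s * Y0 s ω) {ω | G ω = 0}
    - cExp P (fun ω => Y0 t ω - ∑ s ∈ Finset.Icc 1 p, lam s * Y0 s ω) {ω | G ω = j}

theorem cExp_sub_aux {Ω : Type*} [MeasurableSpace Ω] (P : Measure Ω)
    (X Z : Ω → ℝ) (A : Set Ω) (hX : Integrable X P) (hZ : Integrable Z P) :
    cExp P (fun ω => X ω - Z ω) A = cExp P X A - cExp P Z A := by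
  unfold cExp
  rw [integral_sub hX.integrableOn hZ.integrableOn, sub_div]

/-- PTA-II holds if and only if GMC holds at `(λ^DID, w)` for every
`w` in the simplex `Δ_{K−1}`. -/
theorem ptaII_iff_gmc_lamDID_all_w
    {Ω : Type*} [MeasurableSpace Ω] (P : Measure Ω) [IsProbabilityMeasure P]
    (T Tstar K : ℕ) (hT : 2 ≤ T) (hTstar : 1 < Tstar) (hTsT : Tstar ≤ T) (hK : 1 ≤ K)
    (G : Ω → ℕ) (hGmeas : Measurable G) (hGrange : ∀ ω, G ω ≤ K)
    (hPG : ∀ j ≤ K, 0 < P {ω | G ω = j})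
    (Y0 : ℕ → Ω → ℝ) (hY0int : ∀ t ∈ Finset.Icc 1 T, Integrable (Y0 t) P)
    :
    -- PTA-II
    (∀ t ∈ Finset.Icc Tstar T, ∀ j ∈ Finset.Icc 1 K,
        cExp P (fun ω => Y0 t ω - Y0 (t - 1) ω) {ω | G ω = 0}
          = cExp P (fun ω => Y0 t ω - Y0 (t - 1) ω) {ω | G ω = j})
    ↔
    -- GMC at (λ^DID, w) for every w ∈ Δ_{K−1}
    (∀ w : ℕ → ℝ, (∀ j ∈ Finset.Icc 1 K, 0 ≤ w j) →
        (∑ j ∈ Finset.Icc 1 K, w j = 1) →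
        ∀ t ∈ Finset.Icc Tstar T,
          eErr P G Y0 K (Tstar - 1) (fun s => if s = Tstar - 1 then (1 : ℝ) else 0) w t
            = 0) := by
  have hlam : ∀ (t : ℕ) (ω : Ω), Y0 t ω - ∑ s ∈ Finset.Icc 1 (Tstar - 1),
      (fun s => if s = Tstar - 1 then (1 : ℝ) else 0) s * Y0 s ω
      = Y0 t ω - Y0 (Tstar - 1) ω := by
    intro t ω
    congr 1
    rw [Finset.sum_eq_single (Tstar - 1)]
    · simp
    · intro b _ hb
      simp [hb]
    · intro h
      exact absurd (Finset.mem_Icc.mpr ⟨by omega, le_refl _⟩) h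
  have hsub : ∀ a b, 1 ≤ a → a ≤ T → 1 ≤ b → b ≤ T → ∀ A : Set Ω,
      cExp P (fun ω => Y0 a ω - Y0 b ω) A = cExp P (Y0 a) A - cExp P (Y0 b) A := by
    intro a b ha ha' hb hb' A
    exact cExp_sub_aux P _ _ A (hY0int a (Finset.mem_Icc.mpr ⟨ha, ha'⟩))
      (hY0int b (Finset.mem_Icc.mpr ⟨hb, hb'⟩))
  simp only [eErr, hlam]
  constructor
  · intro h w _ hw1 t ht
    have key : ∀ j ∈ Finset.Icc 1 K, ∀ n, Tstar - 1 + n ≤ T →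
        cExp P (Y0 (Tstar - 1 + n)) {ω | G ω = 0} - cExp P (Y0 (Tstar - 1)) {ω | G ω = 0}
        = cExp P (Y0 (Tstar - 1 + n)) {ω | G ω = j}
          - cExp P (Y0 (Tstar - 1)) {ω | G ω = j} := by
      intro j hj n
      induction n with
      | zero => intro _; simp
      | succ n ih =>
        intro hn
        have h1 := ih (by omega)
        have h2 := h (Tstar - 1 + (n + 1)) (Finset.mem_Icc.mpr ⟨by omega, hn⟩) j hj
        have e : Tstar - 1 + (n + 1) - 1 = Tstar - 1 + n := by omega
        rw [e, hsub _ _ (by omega) hn (by omega) (by omega),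
          hsub _ _ (by omega) hn (by omega) (by omega)] at h2
        linarith
    rw [Finset.mem_Icc] at ht
    have hk : ∀ j ∈ Finset.Icc 1 K,
        cExp P (fun ω => Y0 t ω - Y0 (Tstar - 1) ω) {ω | G ω = j}
        = cExp P (fun ω => Y0 t ω - Y0 (Tstar - 1) ω) {ω | G ω = 0} := by
      intro j hj
      have h3 := key j hj (t - (Tstar - 1)) (by omega)
      have e : Tstar - 1 + (t - (Tstar - 1)) = t := by omega
      rw [e] at h3
      rw [hsub _ _ (by omega) (by omega) (by omega) (by omega),
        hsub _ _ (by omega) (by omega) (by omega) (by omega)]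
      exact h3.symm
    rw [Finset.sum_congr rfl (fun j hj => by rw [hk j hj]), ← Finset.sum_mul, hw1]
    ring
  · intro h t ht j hj
    have key : ∀ u ∈ Finset.Icc Tstar T,
        cExp P (Y0 u) {ω | G ω = 0} - cExp P (Y0 (Tstar - 1)) {ω | G ω = 0}
        = cExp P (Y0 u) {ω | G ω = j} - cExp P (Y0 (Tstar - 1)) {ω | G ω = j} := by
      intro u hu
      have h1 := h (fun i => if i = j then 1 else 0)
        (by intro i _; split_ifs <;> norm_num)
        (by
          rw [Finset.sum_eq_single j]
          · simp
          · intro b _ hb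
            simp [hb]
          · intro h; exact absurd hj h) u hu
      rw [Finset.sum_eq_single j (by intro b _ hb; simp [hb])
        (by intro h; exact absurd hj h)] at h1
      rw [Finset.mem_Icc] at hu
      rw [hsub _ _ (by omega) (by omega) (by omega) (by omega),
        hsub _ _ (by omega) (by omega) (by omega) (by omega)] at h1
      simp only [if_true, one_mul] at h1
      linarith
    have k1 := key t ht
    rw [Finset.mem_Icc] at ht
    rw [hsub _ _ (by omega) (by omega) (by omega) (by omega),
      hsub _ _ (by omega) (by omega) (by omega) (by omega)]
    by_cases hc : t = Tstar
    · rw [hc] at k1 ⊢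
      exact k1
    · have k2 := key (t - 1) (Finset.mem_Icc.mpr ⟨by omega, by omega⟩)
      linarith

end
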